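/- (Characterization of valid mean functions for the SSNM.) Consider the SSNM, fix x₀ ∈ X_S, and let γ : X_S → ℝ. Let M_S = {p ∈ ℕ^N : |supp(p)| ≤ S}, and define ν_{x₀}(x) = exp(−‖x₀‖₂²/(2σ²) + ⟨x, x₀⟩/σ²) for x ∈ ℝ^N. Then the following are equivalent: (i) there exists a Borel function ĝ : ℝ^N → ℝ with ∫ ĝ² dP_{x₀} < ∞ that is P_x-integrable with ∫ ĝ dP_x = γ(x) for every x ∈ X_S; (ii) there exists a family (a_p)_{p∈M_S} of reals with Σ_{p∈M_S} a_p² < ∞ such that for every x ∈ X_S the family ((a_p/√(p!)) · (x/σ)^p)_{p∈M_S} is summable with sum equal to ν_{x₀}(x)·γ(x). Moreover, when such a family (a_p) exists, it is unique. -/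

import Mathlib

open MeasureTheory ProbabilityTheory

/-- The distribution `P_x` of `y = x + n` where `n` has i.i.d. `N(0,σ²)` entries
(sparse signal in noise model, SSNM). -/
noncomputable def ssnmP {N : ℕ} (σ : ℝ) (x : Fin N → ℝ) : Measure (Fin N → ℝ) :=
  Measure.map (fun n => x + n)
    (Measure.pi fun _ : Fin N => gaussianReal 0 ((σ ^ 2).toNNReal))

/-- The set `X_S` of `S`-sparse parameter vectors. -/
def sparseSet (N S : ℕ) : Set (Fin N → ℝ) := {x | (Function.support x).ncard ≤ S}

/-- Mean function `γ_ĝ(x) = ∫ ĝ dP_x` of an estimator. -/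
noncomputable def ssnmMean {N : ℕ} (σ : ℝ) (g : (Fin N → ℝ) → ℝ) (x : Fin N → ℝ) : ℝ :=
  ∫ y, g y ∂ ssnmP σ x

/-- Variance `v(ĝ;x) = ∫ (ĝ(y) − γ_ĝ(x))² dP_x(y)` of an estimator. -/
noncomputable def ssnmVar {N : ℕ} (σ : ℝ) (g : (Fin N → ℝ) → ℝ) (x : Fin N → ℝ) : ℝ :=
  ∫ y, (g y - ssnmMean σ g x) ^ 2 ∂ ssnmP σ x

/-- The set `M_S` of multi-indices `p ∈ ℕ^N` with `|supp(p)| ≤ S`. -/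
def MultiIdx (N S : ℕ) : Type := {p : Fin N → ℕ // (Function.support p).ncard ≤ S}

/-- The condition on a square-summable coefficient family `(a_p)_{p∈M_S}`:
for every `x ∈ X_S` the family `((a_p/√(p!)) (x/σ)^p)` is summable with sum
`ν_{x₀}(x) γ(x)`, where `ν_{x₀}(x) = exp(−‖x₀‖²/(2σ²) + ⟨x,x₀⟩/σ²)`. -/
def coeffOK {N S : ℕ} (σ : ℝ) (x₀ : Fin N → ℝ) (γ : (Fin N → ℝ) → ℝ)
    (a : MultiIdx N S → ℝ) : Prop :=
  Summable (fun p => a p ^ 2) ∧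
  ∀ x ∈ sparseSet N S,
    HasSum
      (fun p : MultiIdx N S =>
        (a p / Real.sqrt (∏ i, ((p.1 i).factorial : ℝ))) * ∏ i, (x i / σ) ^ p.1 i)
      (Real.exp (-(∑ i, x₀ i ^ 2) / (2 * σ ^ 2) + (∑ i, x i * x₀ i) / σ ^ 2) * γ x)

open scoped NNReal ENNReal RealInnerProductSpace

section Series

theorem hasSum_mul_real {α β : Type*} {f : α → ℝ} {g : β → ℝ} {s t : ℝ} (hf : HasSum f s)
    (hg : HasSum g t) : HasSum (fun r : α × β => f r.1 * g r.2) (s * t) :=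
  hf.mul hg (summable_mul_of_summable_norm hf.summable.norm hg.summable.norm)

theorem hasSum_fin_pi_prod {n : ℕ} {f : Fin n → ℕ → ℝ} {s : Fin n → ℝ}
    (h : ∀ i, HasSum (f i) (s i)) :
    HasSum (fun p : Fin n → ℕ => ∏ i, f i (p i)) (∏ i, s i) := by
  induction n with
  | zero => simp [hasSum_unique]
  | succ n ih =>
    rw [← (Fin.consEquiv fun _ : Fin (n + 1) => ℕ).hasSum_iff, Fin.prod_univ_succ]
    have h₁ := ih fun i => h i.succ
    have h₂ := hasSum_mul_real (h 0) h₁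
    simpa [Function.comp_def, Fin.prod_univ_succ, Fin.consEquiv] using h₂

theorem eq_zero_of_forall_hasSum_mul_pow {c : ℕ → ℝ}
    (h : ∀ t : ℝ, HasSum (fun k => c k * t ^ k) 0) (k : ℕ) : c k = 0 := by
  have hp : HasFPowerSeriesAt (0 : ℝ → ℝ) (FormalMultilinearSeries.ofScalars ℝ c) 0 := by
    rw [hasFPowerSeriesAt_iff]
    refine Filter.Eventually.of_forall fun z => ?_
    simpa [FormalMultilinearSeries.coeff_ofScalars, mul_comm] using h z
  rw [← FormalMultilinearSeries.coeff_ofScalars (𝕜 := ℝ) (p := c) (n := k), hp.eq_zero]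
  rfl

theorem eq_zero_of_forall_hasSum_mul_prod_pow {n : ℕ} {c : (Fin n → ℕ) → ℝ}
    (h : ∀ x : Fin n → ℝ, HasSum (fun p => c p * ∏ i, x i ^ p i) 0) (p : Fin n → ℕ) :
    c p = 0 := by
  induction n with
  | zero =>
    have h₀ := (hasSum_single p fun q hq => (hq (Subsingleton.elim q p)).elim).unique (h 0)
    simpa using h₀
  | succ n ih =>
    have key (x : Fin n → ℝ) (k : ℕ) :
        HasSum (fun q : Fin n → ℕ => c (Fin.cons k q) * ∏ i, x i ^ q i) 0 := by
      have split (t : ℝ) : HasSum (fun r : ℕ × (Fin n → ℕ) =>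
          c (Fin.cons r.1 r.2) * (t ^ r.1 * ∏ i, x i ^ r.2 i)) 0 := by
        have h' := h (Fin.cons t x)
        rw [← (Fin.consEquiv fun _ : Fin (n + 1) => ℕ).hasSum_iff] at h'
        simpa [Function.comp_def, Fin.prod_univ_succ, Fin.consEquiv] using h'
      have fiber (k : ℕ) :
          Summable (fun q : Fin n → ℕ => c (Fin.cons k q) * ∏ i, x i ^ q i) := by
        simpa using (split 1).summable.prod_factor k
      have coeff := eq_zero_of_forall_hasSum_mul_pow
        (c := fun k => ∑' q : Fin n → ℕ, c (Fin.cons k q) * ∏ i, x i ^ q i) fun t =>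
          (split t).prod_fiberwise fun k => by
            simpa [mul_comm, mul_left_comm, mul_assoc] using (fiber k).hasSum.mul_right (t ^ k)
      have := (fiber k).hasSum
      rwa [coeff k] at this
    have := ih (fun x => key x (p 0)) (Fin.tail p)
    rwa [Fin.cons_self_tail] at this

end Series

section Gram

variable {ι H K : Type*} [NormedAddCommGroup H] [InnerProductSpace ℝ H]
  [NormedAddCommGroup K] [InnerProductSpace ℝ K]

theorem norm_linearCombination_eq_of_inner_eq {u : ι → H} {v : ι → K}
    (h : ∀ i j, ⟪u i, u j⟫ = ⟪v i, v j⟫) (c : ι →₀ ℝ) :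
    ‖Finsupp.linearCombination ℝ u c‖ = ‖Finsupp.linearCombination ℝ v c‖ := by
  rw [← sq_eq_sq₀ (norm_nonneg _) (norm_nonneg _), ← real_inner_self_eq_norm_sq,
    ← real_inner_self_eq_norm_sq]
  simp only [Finsupp.linearCombination_apply, Finsupp.sum, sum_inner, inner_sum,
    real_inner_smul_left, real_inner_smul_right, h]

/-- Two families with the same Gram matrix have the same functions of the form
`i ↦ ⟪g, u i⟫`. -/
theorem exists_inner_eq_of_inner_eq [CompleteSpace K] {u : ι → H} {v : ι → K}
    (h : ∀ i j, ⟪u i, u j⟫ = ⟪v i, v j⟫) (g : H) : ∃ a : K, ∀ i, ⟪a, v i⟫ = ⟪g, u i⟫ := by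
  set T := Finsupp.linearCombination ℝ u
  set U := Finsupp.linearCombination ℝ v
  let f : (ι →₀ ℝ) →ₗ[ℝ] ℝ := (innerSL ℝ g).toLinearMap ∘ₗ T
  have hb : ∃ C : ℝ, ∀ c, ‖f c‖ ≤ C * ‖U c‖ := ⟨‖g‖, fun c => by
    rw [← norm_linearCombination_eq_of_inner_eq h c]
    exact norm_inner_le_norm g (T c)⟩
  obtain ⟨F, hF, -⟩ := exists_extension_norm_eq _ (f.compLeftInverse U)
  refine ⟨(InnerProductSpace.toDual ℝ K).symm F, fun i => ?_⟩
  rw [InnerProductSpace.toDual_symm_apply]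
  have hU : U (Finsupp.single i 1) = v i := by simp [U]
  have hT : T (Finsupp.single i 1) = u i := by simp [T]
  rw [hF ⟨v i, ⟨_, hU⟩⟩, LinearMap.compLeftInverse_apply_of_bdd f U hb _ _ hU]
  simp [f, hT]

end Gram

section GaussianShift

theorem pi_withDensity_ofReal {ι : Type*} [Fintype ι] {α : ι → Type*}
    [∀ i, MeasurableSpace (α i)] {μ : ∀ i, Measure (α i)} [∀ i, SigmaFinite (μ i)]
    {f : ∀ i, α i → ℝ} (hf : ∀ i, Integrable (f i) (μ i)) (hf₀ : ∀ i y, 0 ≤ f i y) :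
    Measure.pi (fun i => (μ i).withDensity fun y => ENNReal.ofReal (f i y)) =
      (Measure.pi μ).withDensity fun y => ENNReal.ofReal (∏ i, f i (y i)) := by
  have (i : ι) : IsFiniteMeasure ((μ i).withDensity fun y => ENNReal.ofReal (f i y)) :=
    isFiniteMeasure_withDensity_ofReal (hf i).2
  refine Measure.pi_eq fun s hs => ?_
  rw [withDensity_apply _ (MeasurableSet.univ_pi hs), Measure.restrict_pi_pi,
    ← ofReal_integral_eq_lintegral_ofReal
      (Integrable.fintype_prod_dep fun i => (hf i).mono_measure Measure.restrict_le_self)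
      (Filter.Eventually.of_forall fun y => Finset.prod_nonneg fun i _ => hf₀ i _),
    integral_fintype_prod_eq_prod,
    ENNReal.ofReal_prod_of_nonneg fun i _ => integral_nonneg (hf₀ i)]
  refine Finset.prod_congr rfl fun i _ => ?_
  rw [withDensity_apply _ (hs i), ofReal_integral_eq_lintegral_ofReal
    ((hf i).mono_measure Measure.restrict_le_self) (Filter.Eventually.of_forall (hf₀ i))]

variable {σ : ℝ}

theorem integrable_exp_linear_gaussianReal (m : ℝ) (v : ℝ≥0) (a b : ℝ) :
    Integrable (fun y => Real.exp (a * y + b)) (gaussianReal m v) := by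
  simpa [Real.exp_add] using (integrable_exp_mul_gaussianReal a).mul_const (Real.exp b)

theorem integral_exp_linear_gaussianReal (m : ℝ) (v : ℝ≥0) (a b : ℝ) :
    ∫ y, Real.exp (a * y + b) ∂gaussianReal m v = Real.exp (m * a + v * a ^ 2 / 2 + b) := by
  have h := congrFun (mgf_fun_id_gaussianReal (μ := m) (v := v)) a
  simp only [mgf] at h
  simp only [Real.exp_add _ b, integral_mul_const, h]

theorem gaussianReal_eq_withDensity_exp (hσ : 0 < σ) (m m₀ : ℝ) :
    gaussianReal m (σ ^ 2).toNNReal = (gaussianReal m₀ (σ ^ 2).toNNReal).withDensity fun y =>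
      ENNReal.ofReal (Real.exp ((m - m₀) / σ ^ 2 * y + -(m ^ 2 - m₀ ^ 2) / (2 * σ ^ 2))) := by
  have hv : (σ ^ 2).toNNReal ≠ 0 := by simpa using hσ.ne'
  rw [gaussianReal_of_var_ne_zero _ hv, gaussianReal_of_var_ne_zero _ hv,
    ← withDensity_mul _ (measurable_gaussianPDF _ _) (by fun_prop)]
  congr 1
  ext y
  rw [Pi.mul_apply, gaussianPDF, gaussianPDF,
    ← ENNReal.ofReal_mul (gaussianPDFReal_nonneg _ _ _), gaussianPDFReal, gaussianPDFReal,
    mul_assoc _ (Real.exp _) (Real.exp _), ← Real.exp_add, Real.coe_toNNReal _ (sq_nonneg σ)]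
  congr 3
  field_simp
  ring

end GaussianShift

section SSNM

variable {N S : ℕ} {σ : ℝ}

theorem ssnmP_eq_pi (σ : ℝ) (x : Fin N → ℝ) :
    ssnmP σ x = Measure.pi fun i => gaussianReal (x i) (σ ^ 2).toNNReal := by
  have h (i : Fin N) : (gaussianReal 0 (σ ^ 2).toNNReal).map (x i + ·) =
      gaussianReal (x i) (σ ^ 2).toNNReal := by
    rw [gaussianReal_map_const_add, zero_add]
  have (i : Fin N) : SigmaFinite ((gaussianReal 0 (σ ^ 2).toNNReal).map (x i + ·)) := by
    rw [h]; infer_instance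
  rw [ssnmP]
  simp_rw [← h]
  exact Measure.pi_map_pi (f := fun i y => x i + y) fun i => by fun_prop

/-- The likelihood ratio `dP_x / dP_{x₀}` multiplied by `ν_{x₀}(x)`. -/
noncomputable def ssnmFeature (σ : ℝ) (x₀ x y : Fin N → ℝ) : ℝ :=
  ∏ i, Real.exp ((x i - x₀ i) / σ ^ 2 * y i + (x i * x₀ i - x i ^ 2 / 2) / σ ^ 2)

theorem measurable_ssnmFeature (x₀ x : Fin N → ℝ) : Measurable (ssnmFeature σ x₀ x) := by
  unfold ssnmFeature; fun_prop

theorem ssnmFeature_mul (x₀ x x' y : Fin N → ℝ) :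
    ssnmFeature σ x₀ x y * ssnmFeature σ x₀ x' y =
      ∏ i, Real.exp (((x i + x' i - 2 * x₀ i) / σ ^ 2) * y i +
        (x i * x₀ i + x' i * x₀ i - x i ^ 2 / 2 - x' i ^ 2 / 2) / σ ^ 2) := by
  rw [ssnmFeature, ssnmFeature, ← Finset.prod_mul_distrib]
  refine Finset.prod_congr rfl fun i _ => ?_
  rw [← Real.exp_add]
  ring_nf

theorem memLp_ssnmFeature (x₀ x : Fin N → ℝ) : MemLp (ssnmFeature σ x₀ x) 2 (ssnmP σ x₀) := by
  rw [memLp_two_iff_integrable_sq (measurable_ssnmFeature x₀ x).aestronglyMeasurable]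
  simp only [sq (ssnmFeature σ x₀ x _), ssnmFeature_mul, ssnmP_eq_pi]
  exact Integrable.fintype_prod fun i => integrable_exp_linear_gaussianReal _ _ _ _

theorem integral_ssnmFeature_mul (hσ : 0 < σ) (x₀ x x' : Fin N → ℝ) :
    ∫ y, ssnmFeature σ x₀ x y * ssnmFeature σ x₀ x' y ∂ssnmP σ x₀ =
      ∏ i, Real.exp (x i / σ * (x' i / σ)) := by
  simp only [ssnmFeature_mul, ssnmP_eq_pi]
  rw [integral_fintype_prod_eq_prod (fun i y => Real.exp (((x i + x' i - 2 * x₀ i) / σ ^ 2) * y +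
        (x i * x₀ i + x' i * x₀ i - x i ^ 2 / 2 - x' i ^ 2 / 2) / σ ^ 2))]
  refine Finset.prod_congr rfl fun i _ => ?_
  rw [integral_exp_linear_gaussianReal, Real.coe_toNNReal _ (sq_nonneg σ)]
  congr 1
  field_simp
  ring

theorem ssnmP_eq_withDensity (hσ : 0 < σ) (x₀ x : Fin N → ℝ) :
    ssnmP σ x = (ssnmP σ x₀).withDensity fun y => ENNReal.ofReal
      ((Real.exp (-(∑ i, x₀ i ^ 2) / (2 * σ ^ 2) + (∑ i, x i * x₀ i) / σ ^ 2))⁻¹ *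
        ssnmFeature σ x₀ x y) := by
  rw [ssnmP_eq_pi, ssnmP_eq_pi]
  simp_rw [fun i => gaussianReal_eq_withDensity_exp hσ (x i) (x₀ i)]
  rw [pi_withDensity_ofReal (fun i => integrable_exp_linear_gaussianReal _ _ _ _)
    fun i y => (Real.exp_pos _).le]
  congr 1
  ext y
  rw [ssnmFeature, ← Real.exp_sum, ← Real.exp_sum, ← Real.exp_neg, ← Real.exp_add,
    neg_div, Finset.sum_div, Finset.sum_div, ← Finset.sum_neg_distrib,
    ← Finset.sum_add_distrib, ← Finset.sum_neg_distrib, ← Finset.sum_add_distrib]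
  congr 3
  ext i
  field_simp
  ring

theorem integrable_ssnmP_iff (hσ : 0 < σ) (x₀ x : Fin N → ℝ) (g : (Fin N → ℝ) → ℝ) :
    Integrable g (ssnmP σ x) ↔ Integrable (fun y => g y * ssnmFeature σ x₀ x y) (ssnmP σ x₀) := by
  have hpos (y) : 0 < ssnmFeature σ x₀ x y := Finset.prod_pos fun i _ => Real.exp_pos _
  have hm := measurable_ssnmFeature (σ := σ) x₀ x
  rw [ssnmP_eq_withDensity hσ x₀ x, integrable_withDensity_iff_integrable_smul' (by fun_prop)
    (by simp)]
  simp_rw [ENNReal.toReal_ofReal (mul_pos (inv_pos.2 (Real.exp_pos _)) (hpos _)).le, smul_eq_mul,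
    mul_assoc]
  rw [integrable_const_mul_iff (by simp)]
  simp_rw [mul_comm]

theorem integral_mul_ssnmFeature (hσ : 0 < σ) (x₀ x : Fin N → ℝ) (g : (Fin N → ℝ) → ℝ) :
    ∫ y, g y * ssnmFeature σ x₀ x y ∂ssnmP σ x₀ =
      Real.exp (-(∑ i, x₀ i ^ 2) / (2 * σ ^ 2) + (∑ i, x i * x₀ i) / σ ^ 2) *
        ∫ y, g y ∂ssnmP σ x := by
  have hpos (y) : 0 < ssnmFeature σ x₀ x y := Finset.prod_pos fun i _ => Real.exp_pos _
  have hm := measurable_ssnmFeature (σ := σ) x₀ x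
  rw [ssnmP_eq_withDensity hσ x₀ x, integral_withDensity_eq_integral_toReal_smul (by fun_prop)
    (by simp)]
  simp_rw [ENNReal.toReal_ofReal (mul_pos (inv_pos.2 (Real.exp_pos _)) (hpos _)).le, smul_eq_mul,
    mul_assoc]
  rw [integral_const_mul, mul_inv_cancel_left₀ (Real.exp_pos _).ne']
  simp_rw [mul_comm]

theorem prod_pow_eq_zero_of_not_support_subset {x : Fin N → ℝ} {p : Fin N → ℕ}
    (h : ¬ Function.support p ⊆ Function.support x) (σ : ℝ) : ∏ i, (x i / σ) ^ p i = 0 := by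
  obtain ⟨i, hi, hx⟩ := Set.not_subset.1 h
  refine Finset.prod_eq_zero (Finset.mem_univ i) ?_
  rw [Function.notMem_support.1 hx, zero_div, zero_pow hi]

/-- The normalized monomial `(x/σ)^p / √(p!)`. -/
noncomputable def ssnmMonomial (σ : ℝ) (x : Fin N → ℝ) (p : MultiIdx N S) : ℝ :=
  (∏ i, (x i / σ) ^ p.1 i) / Real.sqrt (∏ i, ((p.1 i).factorial : ℝ))

theorem hasSum_ssnmMonomial_mul {x : Fin N → ℝ} (hx : x ∈ sparseSet N S) (x' : Fin N → ℝ) :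
    HasSum (fun p : MultiIdx N S => ssnmMonomial σ x p * ssnmMonomial σ x' p)
      (∏ i, Real.exp (x i / σ * (x' i / σ))) := by
  simp only [Real.exp_eq_exp_ℝ]
  have h := hasSum_fin_pi_prod fun i =>
    NormedSpace.expSeries_div_hasSum_exp (x i / σ * (x' i / σ))
  have hinj : Function.Injective (fun p : MultiIdx N S => p.1) :=
    Subtype.val_injective
  rw [← hinj.hasSum_iff] at h
  · convert h using 2 with p
    have hp : 0 ≤ ∏ i, ((p.1 i).factorial : ℝ) := by positivity
    rw [ssnmMonomial, ssnmMonomial, div_mul_div_comm, Real.mul_self_sqrt hp,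
      ← Finset.prod_mul_distrib, Function.comp_apply, ← Finset.prod_div_distrib]
    simp_rw [mul_pow]
  · intro p hp
    have hsub : ¬ Function.support p ⊆ Function.support x := fun hsub =>
      hp ⟨⟨p, (Set.ncard_le_ncard hsub).trans hx⟩, rfl⟩
    simp_rw [mul_pow, Finset.prod_div_distrib, Finset.prod_mul_distrib,
      prod_pow_eq_zero_of_not_support_subset hsub, zero_mul, zero_div]

theorem memℓp_ssnmMonomial {x : Fin N → ℝ} (hx : x ∈ sparseSet N S) :
    Memℓp (ssnmMonomial σ x : MultiIdx N S → ℝ) 2 := by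
  rw [memℓp_gen_iff (by norm_num)]
  simpa [sq] using (hasSum_ssnmMonomial_mul (σ := σ) hx x).summable

theorem coeffOK_unique (hσ : 0 < σ) {x₀ : Fin N → ℝ} {γ : (Fin N → ℝ) → ℝ}
    {a a' : MultiIdx N S → ℝ} (ha : coeffOK σ x₀ γ a) (ha' : coeffOK σ x₀ γ a') : a = a' := by
  classical
  funext p
  let c (q : Fin N → ℕ) : ℝ :=
    if h : Function.support q ⊆ Function.support p.1 then
      (a ⟨q, (Set.ncard_le_ncard h).trans p.2⟩ - a' ⟨q, (Set.ncard_le_ncard h).trans p.2⟩) /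
        Real.sqrt (∏ i, ((q i).factorial : ℝ))
    else 0
  have hc : c p.1 = 0 := by
    refine eq_zero_of_forall_hasSum_mul_prod_pow (fun x => ?_) p.1
    let z : Fin N → ℝ := (Function.support p.1).indicator fun i => σ * x i
    have hz : Function.support z ⊆ Function.support p.1 := Set.support_indicator_subset
    have h := ((ha.2 z ((Set.ncard_le_ncard hz).trans p.2)).sub
      (ha'.2 z ((Set.ncard_le_ncard hz).trans p.2)))
    rw [sub_self] at h
    have hinj : Function.Injective (fun p : MultiIdx N S => p.1) :=
      Subtype.val_injective
    rw [← hinj.hasSum_iff]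
    · convert! h using 2 with q
      rw [← sub_mul, ← sub_div, Function.comp_apply]
      by_cases hq : Function.support q.1 ⊆ Function.support p.1
      · simp only [c, dif_pos hq]
        congr 1
        refine Finset.prod_congr rfl fun i _ => ?_
        by_cases hi : i ∈ Function.support p.1
        · rw [show z i = σ * x i from Set.indicator_of_mem hi _, mul_div_cancel_left₀ _ hσ.ne']
        · have hqi : q.1 i = 0 := Function.notMem_support.1 fun h => hi (hq h)
          rw [hqi, pow_zero, pow_zero]
      · rw [prod_pow_eq_zero_of_not_support_subset fun h => hq (h.trans hz)]
        simp only [c, dif_neg hq, zero_mul, mul_zero]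
    · intro q hq
      have : ¬ Function.support q ⊆ Function.support p.1 := fun hsub =>
        hq ⟨⟨q, (Set.ncard_le_ncard hsub).trans p.2⟩, rfl⟩
      simp only [c, dif_neg this, zero_mul]
  simp only [c, dif_pos subset_rfl] at hc
  have hp : 0 < ∏ i, ((p.1 i).factorial : ℝ) :=
    Finset.prod_pos fun i _ => by exact_mod_cast Nat.factorial_pos _
  exact sub_eq_zero.1 ((div_eq_zero_iff.1 hc).resolve_right (Real.sqrt_pos.2 hp).ne')

/-- `ssnmFeature` as an element of `L²(P_{x₀})`. -/
noncomputable def ssnmFeatureLp (σ : ℝ) (x₀ x : Fin N → ℝ) : Lp ℝ 2 (ssnmP σ x₀) :=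
  (memLp_ssnmFeature x₀ x).toLp

/-- `ssnmMonomial` as an element of `ℓ²(M_S)`. -/
noncomputable def ssnmMonomialLp (σ : ℝ) (x : sparseSet N S) :
    lp (fun _ : MultiIdx N S => ℝ) 2 :=
  ⟨ssnmMonomial σ x.1, memℓp_ssnmMonomial x.2⟩

theorem inner_ssnmFeatureLp_right {x₀ : Fin N → ℝ} (x : Fin N → ℝ) {g : (Fin N → ℝ) → ℝ}
    {G : Lp ℝ 2 (ssnmP σ x₀)} (hg : G =ᵐ[ssnmP σ x₀] g) :
    ⟪G, ssnmFeatureLp σ x₀ x⟫ = ∫ y, g y * ssnmFeature σ x₀ x y ∂ssnmP σ x₀ := by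
  rw [L2.inner_def]
  refine integral_congr_ae ?_
  filter_upwards [hg, (memLp_ssnmFeature (σ := σ) x₀ x).coeFn_toLp] with y hy hy'
  rw [hy, ssnmFeatureLp, hy']
  simp [mul_comm]

theorem inner_ssnmFeatureLp_eq_inner_ssnmMonomialLp (hσ : 0 < σ) (x₀ : Fin N → ℝ)
    (x x' : sparseSet N S) :
    ⟪ssnmFeatureLp σ x₀ x.1, ssnmFeatureLp σ x₀ x'.1⟫ =
      ⟪ssnmMonomialLp σ x, ssnmMonomialLp σ x'⟫ := by
  rw [inner_ssnmFeatureLp_right (G := ssnmFeatureLp σ x₀ x.1) _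
      (memLp_ssnmFeature x₀ x.1).coeFn_toLp, integral_ssnmFeature_mul hσ]
  refine (hasSum_ssnmMonomial_mul x.2 x'.1).unique ?_
  simpa [ssnmMonomialLp, mul_comm] using
    lp.hasSum_inner (𝕜 := ℝ) (ssnmMonomialLp σ x) (ssnmMonomialLp σ x')

theorem coeffOK_iff_inner {x₀ : Fin N → ℝ} {γ : (Fin N → ℝ) → ℝ} {a : MultiIdx N S → ℝ} :
    coeffOK σ x₀ γ a ↔ ∃ A : lp (fun _ : MultiIdx N S => ℝ) 2, (A : MultiIdx N S → ℝ) = a ∧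
      ∀ x : sparseSet N S, ⟪A, ssnmMonomialLp σ x⟫ =
        Real.exp (-(∑ i, x₀ i ^ 2) / (2 * σ ^ 2) + (∑ i, x.1 i * x₀ i) / σ ^ 2) * γ x := by
  have hinner (A : lp (fun _ : MultiIdx N S => ℝ) 2) (x : sparseSet N S) :
      HasSum (fun p => A p / Real.sqrt (∏ i, ((p.1 i).factorial : ℝ)) *
        ∏ i, (x.1 i / σ) ^ p.1 i) ⟪A, ssnmMonomialLp σ x⟫ := by
    convert! lp.hasSum_inner (𝕜 := ℝ) A (ssnmMonomialLp σ x) using 2 with p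
    simp only [ssnmMonomialLp, ssnmMonomial, RCLike.inner_apply, conj_trivial]
    ring
  constructor
  · rintro ⟨h₁, h₂⟩
    have hmem : Memℓp a 2 := by
      rw [memℓp_gen_iff (by norm_num)]
      simpa using h₁
    exact ⟨⟨a, hmem⟩, rfl, fun x => (hinner ⟨a, hmem⟩ x).unique (h₂ x.1 x.2)⟩
  · rintro ⟨A, rfl, hA⟩
    refine ⟨?_, fun x hx => hA ⟨x, hx⟩ ▸ hinner A ⟨x, hx⟩⟩
    simpa using (memℓp_gen_iff (by norm_num)).1 (lp.memℓp A)

theorem exists_estimator_iff_inner (hσ : 0 < σ) {x₀ : Fin N → ℝ} {γ : (Fin N → ℝ) → ℝ} :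
    (∃ g : (Fin N → ℝ) → ℝ, Measurable g ∧ Integrable (fun y => g y ^ 2) (ssnmP σ x₀) ∧
        ∀ x ∈ sparseSet N S, Integrable g (ssnmP σ x) ∧ (∫ y, g y ∂ssnmP σ x) = γ x) ↔
      ∃ G : Lp ℝ 2 (ssnmP σ x₀), ∀ x : sparseSet N S, ⟪G, ssnmFeatureLp σ x₀ x.1⟫ =
        Real.exp (-(∑ i, x₀ i ^ 2) / (2 * σ ^ 2) + (∑ i, x.1 i * x₀ i) / σ ^ 2) * γ x := by
  constructor
  · rintro ⟨g, hgm, hg2, hg⟩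
    have hmem := (memLp_two_iff_integrable_sq hgm.aestronglyMeasurable).2 hg2
    refine ⟨hmem.toLp, fun x => ?_⟩
    rw [inner_ssnmFeatureLp_right _ hmem.coeFn_toLp, integral_mul_ssnmFeature hσ,
      (hg x.1 x.2).2]
  · rintro ⟨G, hG⟩
    refine ⟨G, (Lp.stronglyMeasurable G).measurable, (Lp.memLp G).integrable_sq, fun x hx => ?_⟩
    refine ⟨(integrable_ssnmP_iff hσ x₀ x _).2
      ((Lp.memLp G).integrable_mul (memLp_ssnmFeature x₀ x)), ?_⟩
    have h := hG ⟨x, hx⟩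
    rw [inner_ssnmFeatureLp_right _ Filter.EventuallyEq.rfl, integral_mul_ssnmFeature hσ] at h
    exact mul_left_cancel₀ (Real.exp_pos _).ne' h

end SSNM

/-- Characterization of valid mean functions for the SSNM.
A function `γ : X_S → ℝ` is the mean function of some estimator with finite variance at
`x₀` if and only if there is a square-summable family `(a_p)_{p∈M_S}` with
`ν_{x₀}(x) γ(x) = Σ_{p∈M_S} (a_p/√(p!)) (x/σ)^p` for all `x ∈ X_S`; moreover, such a
family is unique. -/
theorem ssnm_valid_mean_characterization {N S : ℕ} (hN : 1 ≤ N) (hS1 : 1 ≤ S)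
    (hSN : S ≤ N) (σ : ℝ) (hσ : 0 < σ)
    (x₀ : Fin N → ℝ) (hx₀ : x₀ ∈ sparseSet N S)
    (γ : (Fin N → ℝ) → ℝ) :
    ((∃ g : (Fin N → ℝ) → ℝ, Measurable g ∧
        Integrable (fun y => g y ^ 2) (ssnmP σ x₀) ∧
        ∀ x ∈ sparseSet N S, Integrable g (ssnmP σ x) ∧ (∫ y, g y ∂ ssnmP σ x) = γ x)
      ↔ (∃ a : MultiIdx N S → ℝ, coeffOK σ x₀ γ a))
    ∧ ∀ a a' : MultiIdx N S → ℝ, coeffOK σ x₀ γ a → coeffOK σ x₀ γ a' → a = a' := by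
  refine ⟨?_, fun a a' ha ha' => coeffOK_unique hσ ha ha'⟩
  rw [exists_estimator_iff_inner hσ]
  simp only [coeffOK_iff_inner]
  have hgram := inner_ssnmFeatureLp_eq_inner_ssnmMonomialLp (S := S) hσ x₀
  constructor
  · rintro ⟨G, hG⟩
    obtain ⟨A, hA⟩ := exists_inner_eq_of_inner_eq hgram G
    exact ⟨A, A, rfl, fun x => (hA x).trans (hG x)⟩
  · rintro ⟨_, A, -, hA⟩
    obtain ⟨G, hG⟩ := exists_inner_eq_of_inner_eq (fun x x' => (hgram x x').symm) A
    exact ⟨G, fun x => (hG x).trans (hA x)⟩
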